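/- arXiv:2509.26635 — 2 statements merged into one kernel-verified Lean document; each statement's English description precedes it below -/
import Mathlib

section
/- For every generator f, letting X, X' be independent random variables each with density f, the quantity ξ(f) := 12 Var(X) − 6 E|X − X'| + 1 satisfies 0 ≤ ξ(f) < 1, and ξ(f) = 0 if and only if f(x) = 1 for almost every x ∈ [0,1]. Equivalently, writing ρ(f) := 6E[X(1−X)] − 1 and τ(f) := 4E[X(1−X)] + 2E|X−X'| − 4Var(X) − 1, one has ξ(f) = 2ρ(f) − 3τ(f), and 2ρ(f) = 3τ(f) holds if and only if f is the Unif(0,1) density almost everywhere. -/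
open MeasureTheory

/-- A generator: a probability density on `[0,1]`. -/
def IsGenerator (f : ℝ → ℝ) : Prop :=
  Measurable f ∧ (∀ x ∈ Set.Icc (0:ℝ) 1, 0 ≤ f x) ∧ ∫ x in Set.Icc (0:ℝ) 1, f x = 1

/-- `Var(X)` for `X` with density `f` on `[0,1]`. -/
noncomputable def genVar (f : ℝ → ℝ) : ℝ :=
  (∫ x in Set.Icc (0:ℝ) 1, x ^ 2 * f x) - (∫ x in Set.Icc (0:ℝ) 1, x * f x) ^ 2

/-- `E|X - X'|` for `X, X'` iid with density `f` on `[0,1]`. -/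
noncomputable def genMAD (f : ℝ → ℝ) : ℝ :=
  ∫ u in Set.univ.pi (fun _ : Fin 2 => Set.Icc (0:ℝ) 1), |u 0 - u 1| * (f (u 0) * f (u 1))

/-- Spearman's rho `ρ(f) = 6 E[X(1-X)] - 1`. -/
noncomputable def spearmanRho (f : ℝ → ℝ) : ℝ :=
  6 * (∫ x in Set.Icc (0:ℝ) 1, x * (1 - x) * f x) - 1

/-- Kendall's tau `τ(f) = 4 E[X(1-X)] + 2 E|X - X'| - 4 Var(X) - 1`. -/
noncomputable def kendallTau (f : ℝ → ℝ) : ℝ :=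
  4 * (∫ x in Set.Icc (0:ℝ) 1, x * (1 - x) * f x) + 2 * genMAD f - 4 * genVar f - 1

/-- The Dette–Siburg–Stoimenov coefficient `ξ(f) = 12 Var(X) - 6 E|X - X'| + 1`. -/
noncomputable def dssXi (f : ℝ → ℝ) : ℝ :=
  12 * genVar f - 6 * genMAD f + 1

/-- The function `x ↦ 1_{x ≤ t} - t + x - 1/2`, which has mean zero in `t` over `[0,1]`. -/
noncomputable def centeredStep (x t : ℝ) : ℝ :=
  (Set.Ici x).indicator 1 t - t + x - 1 / 2

lemma measurable_centeredStep : Measurable (fun p : ℝ × ℝ => centeredStep p.1 p.2) := by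
  have h : Measurable (fun p : ℝ × ℝ => (Set.Ici p.1).indicator (1 : ℝ → ℝ) p.2) := by
    have : (fun p : ℝ × ℝ => (Set.Ici p.1).indicator (1 : ℝ → ℝ) p.2)
        = {p : ℝ × ℝ | p.1 ≤ p.2}.indicator 1 := by
      ext p
      simp [Set.indicator_apply]
    rw [this]
    exact measurable_one.indicator (measurableSet_le measurable_fst measurable_snd)
  unfold centeredStep
  fun_prop

lemma abs_centeredStep_le {x t : ℝ} (hx : x ∈ Set.Icc (0:ℝ) 1) (ht : t ∈ Set.Icc (0:ℝ) 1) :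
    |centeredStep x t| ≤ 2 := by
  obtain ⟨hx0, hx1⟩ := hx
  obtain ⟨ht0, ht1⟩ := ht
  by_cases h : x ≤ t <;> simp only [centeredStep, Set.indicator_apply, Set.mem_Ici, h, if_true,
    if_false, Pi.one_apply, abs_le] <;> constructor <;> linarith

lemma setIntegral_indicator_Ici_mul {x : ℝ} (hx : x ∈ Set.Icc (0:ℝ) 1) (g : ℝ → ℝ) :
    ∫ t in Set.Icc (0:ℝ) 1, (Set.Ici x).indicator 1 t * g t = ∫ t in x..1, g t := by
  have h : ∀ t, (Set.Ici x).indicator (1 : ℝ → ℝ) t * g t = (Set.Ici x).indicator g t := by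
    intro t
    by_cases ht : t ∈ Set.Ici x <;> simp [ht]
  simp_rw [h]
  rw [setIntegral_indicator measurableSet_Ici, intervalIntegral.integral_of_le hx.2,
    ← integral_Icc_eq_integral_Ioc]
  congr 2
  ext t
  simp only [Set.mem_inter_iff, Set.mem_Icc, Set.mem_Ici]
  exact ⟨fun h => ⟨h.2, h.1.2⟩, fun h => ⟨⟨hx.1.trans h.1, h.2⟩, h.1⟩⟩

lemma integrableOn_indicator_Ici_mul (x : ℝ) {g : ℝ → ℝ} (hg : Continuous g) :
    IntegrableOn (fun t => (Set.Ici x).indicator 1 t * g t) (Set.Icc (0:ℝ) 1) := by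
  have h : (fun t => (Set.Ici x).indicator (1 : ℝ → ℝ) t * g t) = (Set.Ici x).indicator g := by
    ext t
    by_cases ht : t ∈ Set.Ici x <;> simp [ht]
  rw [h]
  exact (hg.continuousOn.integrableOn_Icc).indicator measurableSet_Ici

lemma intervalIntegral_quadratic (a b c u v : ℝ) :
    ∫ t in u..v, (a + b * t + c * t ^ 2)
      = a * (v - u) + b * ((v ^ 2 - u ^ 2) / 2) + c * ((v ^ 3 - u ^ 3) / 3) := by
  rw [intervalIntegral.integral_add, intervalIntegral.integral_add]
  · rw [intervalIntegral.integral_const_mul, intervalIntegral.integral_const_mul, integral_id,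
      intervalIntegral.integral_const, integral_pow, smul_eq_mul]
    norm_num
    ring
  all_goals exact Continuous.intervalIntegrable (by fun_prop) _ _

lemma setIntegral_centeredStep_mul_of_le {x y : ℝ} (hx : x ∈ Set.Icc (0:ℝ) 1)
    (hy : y ∈ Set.Icc (0:ℝ) 1) (hxy : x ≤ y) :
    12 * ∫ t in Set.Icc (0:ℝ) 1, centeredStep x t * centeredStep y t
      = 6 * (x - y) ^ 2 - 6 * |x - y| + 1 := by
  have h : ∀ t, centeredStep x t * centeredStep y t
      = (Set.Ici x).indicator 1 t * ((y - 1 / 2) + (-1) * t + 0 * t ^ 2)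
        + (Set.Ici y).indicator 1 t * ((x + 1 / 2) + (-1) * t + 0 * t ^ 2)
        + ((x - 1 / 2) * (y - 1 / 2) + (1 - x - y) * t + 1 * t ^ 2) := by
    intro t
    unfold centeredStep
    by_cases h1 : y ≤ t
    · simp [hxy.trans h1, h1]
      ring
    · simp [h1]
      ring
  simp_rw [h]
  rw [integral_add, integral_add, setIntegral_indicator_Ici_mul hx,
    setIntegral_indicator_Ici_mul hy, integral_Icc_eq_integral_Ioc,
    ← intervalIntegral.integral_of_le zero_le_one]
  · simp only [intervalIntegral_quadratic]
    rw [abs_of_nonpos (by linarith)]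
    ring
  · exact integrableOn_indicator_Ici_mul x (by fun_prop)
  · exact integrableOn_indicator_Ici_mul y (by fun_prop)
  · exact (integrableOn_indicator_Ici_mul x (by fun_prop)).add
      (integrableOn_indicator_Ici_mul y (by fun_prop))
  · exact (Continuous.continuousOn (by fun_prop)).integrableOn_Icc

lemma setIntegral_centeredStep_mul {x y : ℝ} (hx : x ∈ Set.Icc (0:ℝ) 1)
    (hy : y ∈ Set.Icc (0:ℝ) 1) :
    12 * ∫ t in Set.Icc (0:ℝ) 1, centeredStep x t * centeredStep y t
      = 6 * (x - y) ^ 2 - 6 * |x - y| + 1 := by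
  rcases le_total x y with h | h
  · exact setIntegral_centeredStep_mul_of_le hx hy h
  · simp_rw [mul_comm (centeredStep x _)]
    rw [setIntegral_centeredStep_mul_of_le hy hx h, abs_sub_comm]
    ring

section Measure

variable {ν : Measure ℝ}

lemma ae_prod_mem_Icc (hν : ∀ᵐ x ∂ν, x ∈ Set.Icc (0:ℝ) 1) :
    ∀ᵐ p ∂(ν.prod ν), p.1 ∈ Set.Icc (0:ℝ) 1 ∧ p.2 ∈ Set.Icc (0:ℝ) 1 :=
  (Measure.quasiMeasurePreserving_fst.ae hν).and (Measure.quasiMeasurePreserving_snd.ae hν)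

variable [IsProbabilityMeasure ν]

lemma integral_quadratic_kernel_eq (hν : ∀ᵐ x ∂ν, x ∈ Set.Icc (0:ℝ) 1) :
    ∫ p, (6 * (p.1 - p.2) ^ 2 - 6 * |p.1 - p.2| + 1) ∂(ν.prod ν)
      = 12 * ∫ t in Set.Icc (0:ℝ) 1, (∫ x, centeredStep x t ∂ν) ^ 2 := by
  have hm := measurable_centeredStep
  calc ∫ p, (6 * (p.1 - p.2) ^ 2 - 6 * |p.1 - p.2| + 1) ∂(ν.prod ν)
      = ∫ p, 12 * (∫ t in Set.Icc (0:ℝ) 1, centeredStep p.1 t * centeredStep p.2 t)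
          ∂(ν.prod ν) := by
        refine integral_congr_ae ?_
        filter_upwards [ae_prod_mem_Icc hν] with p hp
        exact (setIntegral_centeredStep_mul hp.1 hp.2).symm
    _ = 12 * ∫ t in Set.Icc (0:ℝ) 1,
          (∫ p, centeredStep p.1 t * centeredStep p.2 t ∂(ν.prod ν)) := by
        rw [integral_const_mul, integral_integral_swap]
        refine Integrable.of_bound (C := 2 * 2) ?_ ?_
        · refine Measurable.aestronglyMeasurable ?_
          exact (hm.comp (by fun_prop : Measurable fun q : (ℝ × ℝ) × ℝ => (q.1.1, q.2))).mul
            (hm.comp (by fun_prop : Measurable fun q : (ℝ × ℝ) × ℝ => (q.1.2, q.2)))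
        · have h1 := (Measure.quasiMeasurePreserving_fst
            (μ := ν.prod ν) (ν := volume.restrict (Set.Icc (0:ℝ) 1))).ae (ae_prod_mem_Icc hν)
          have h2 := (Measure.quasiMeasurePreserving_snd
            (μ := ν.prod ν) (ν := volume.restrict (Set.Icc (0:ℝ) 1))).ae
              (ae_restrict_mem measurableSet_Icc)
          filter_upwards [h1, h2] with q hq hq'
          simp only [Function.uncurry, norm_mul, Real.norm_eq_abs]
          exact mul_le_mul (abs_centeredStep_le hq.1 hq') (abs_centeredStep_le hq.2 hq')
            (abs_nonneg _) (by norm_num)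
    _ = 12 * ∫ t in Set.Icc (0:ℝ) 1, (∫ x, centeredStep x t ∂ν) ^ 2 := by
        congr 2
        ext t
        rw [integral_prod_mul (fun x => centeredStep x t) (fun x => centeredStep x t), sq]

lemma integrable_of_continuous_prod (hν : ∀ᵐ x ∂ν, x ∈ Set.Icc (0:ℝ) 1) {g : ℝ × ℝ → ℝ}
    (hg : Continuous g) : Integrable g (ν.prod ν) := by
  obtain ⟨C, hC⟩ := ((isCompact_Icc (a := (0:ℝ)) (b := 1)).prod
    (isCompact_Icc (a := (0:ℝ)) (b := 1))).exists_bound_of_continuousOn hg.continuousOn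
  refine Integrable.of_bound hg.aestronglyMeasurable C ?_
  filter_upwards [ae_prod_mem_Icc hν] with p hp using hC p hp

lemma integrable_of_continuous_of_ae_mem_Icc (hν : ∀ᵐ x ∂ν, x ∈ Set.Icc (0:ℝ) 1) {g : ℝ → ℝ}
    (hg : Continuous g) : Integrable g ν := by
  obtain ⟨C, hC⟩ := (isCompact_Icc (a := (0:ℝ)) (b := 1)).exists_bound_of_continuousOn
    hg.continuousOn
  refine Integrable.of_bound hg.aestronglyMeasurable C ?_
  filter_upwards [hν] with p hp using hC p hp

lemma integral_sq_sub_eq (hν : ∀ᵐ x ∂ν, x ∈ Set.Icc (0:ℝ) 1) :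
    ∫ p, (p.1 - p.2) ^ 2 ∂(ν.prod ν) = 2 * ((∫ x, x ^ 2 ∂ν) - (∫ x, x ∂ν) ^ 2) := by
  have h : ∀ p : ℝ × ℝ, (p.1 - p.2) ^ 2 = p.1 ^ 2 * 1 + 1 * p.2 ^ 2 - 2 * (p.1 * p.2) := by
    intro p
    ring
  simp_rw [h]
  rw [integral_sub (integrable_of_continuous_prod hν (by fun_prop))
    (integrable_of_continuous_prod hν (by fun_prop)),
    integral_add (integrable_of_continuous_prod hν (by fun_prop))
    (integrable_of_continuous_prod hν (by fun_prop)),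
    integral_prod_mul (fun x : ℝ => x ^ 2) (fun _ : ℝ => (1:ℝ)),
    integral_prod_mul (fun _ : ℝ => (1:ℝ)) (fun x : ℝ => x ^ 2), integral_const_mul,
    integral_prod_mul (fun x : ℝ => x) (fun x : ℝ => x)]
  simp
  ring

lemma integral_sq_sub_lt_integral_abs_sub [NullSingletonClass ν] (hν : ∀ᵐ x ∂ν, x ∈ Set.Icc (0:ℝ) 1) :
    ∫ p, (p.1 - p.2) ^ 2 ∂(ν.prod ν) < ∫ p, |p.1 - p.2| ∂(ν.prod ν) := by
  have hi1 : Integrable (fun p : ℝ × ℝ => |p.1 - p.2|) (ν.prod ν) :=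
    integrable_of_continuous_prod hν (by fun_prop)
  have hi2 : Integrable (fun p : ℝ × ℝ => (p.1 - p.2) ^ 2) (ν.prod ν) :=
    integrable_of_continuous_prod hν (by fun_prop)
  have hnn : 0 ≤ᵐ[ν.prod ν] fun p : ℝ × ℝ => |p.1 - p.2| - (p.1 - p.2) ^ 2 := by
    filter_upwards [ae_prod_mem_Icc hν] with p ⟨⟨h1, h2⟩, h3, h4⟩
    have h5 : |p.1 - p.2| ≤ 1 := abs_le.mpr ⟨by linarith, by linarith⟩
    have h6 := abs_nonneg (p.1 - p.2)
    rw [Pi.zero_apply, ← sq_abs]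
    nlinarith
  rw [← sub_pos, ← integral_sub hi1 hi2]
  refine lt_of_le_of_ne (integral_nonneg_of_ae hnn) fun h0 => ?_
  have hz := (integral_eq_zero_iff_of_nonneg_ae hnn (hi1.sub hi2)).mp h0.symm
  obtain ⟨x, hx⟩ := (Measure.ae_ae_of_ae_prod hz).exists
  have hfin : ∀ᵐ y ∂ν, y ∉ ({x, x + 1, x - 1} : Set ℝ) :=
    measure_eq_zero_iff_ae_notMem.mp ((Set.toFinite _).measure_zero ν)
  obtain ⟨y, hy, hy'⟩ := (hx.and hfin).exists
  simp only [Pi.zero_apply, ← sq_abs (x - y)] at hy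
  simp only [Set.mem_insert_iff, Set.mem_singleton_iff, not_or] at hy'
  have hfac : |x - y| * (1 - |x - y|) = 0 := by linarith
  rcases mul_eq_zero.mp hfac with h | h
  · exact hy'.1 (by linarith [abs_eq_zero.mp h])
  · rcases eq_or_eq_neg_of_abs_eq (by linarith : |x - y| = 1) with h | h
    · exact hy'.2.2 (by linarith)
    · exact hy'.2.1 (by linarith)

end Measure

/-- The probability measure on `ℝ` carried by `[0,1]` with density `f`. -/
noncomputable def genMeasure (f : ℝ → ℝ) : Measure ℝ :=
  (volume.restrict (Set.Icc (0:ℝ) 1)).withDensity fun x => ENNReal.ofReal (f x)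

namespace IsGenerator

variable {f : ℝ → ℝ}

lemma ae_nonneg (hf : IsGenerator f) :
    0 ≤ᵐ[volume.restrict (Set.Icc (0:ℝ) 1)] f :=
  (ae_restrict_iff' measurableSet_Icc).mpr (.of_forall hf.2.1)

lemma integrableOn (hf : IsGenerator f) : IntegrableOn f (Set.Icc (0:ℝ) 1) := by
  refine Integrable.of_integral_ne_zero ?_
  rw [hf.2.2]
  exact one_ne_zero

lemma isProbabilityMeasure (hf : IsGenerator f) : IsProbabilityMeasure (genMeasure f) := by
  constructor
  rw [genMeasure, withDensity_apply _ MeasurableSet.univ, Measure.restrict_univ,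
    ← ofReal_integral_eq_lintegral_ofReal hf.integrableOn hf.ae_nonneg, hf.2.2,
    ENNReal.ofReal_one]

lemma integral_genMeasure (hf : IsGenerator f) (g : ℝ → ℝ) :
    ∫ x, g x ∂(genMeasure f) = ∫ x in Set.Icc (0:ℝ) 1, g x * f x := by
  rw [genMeasure, integral_withDensity_eq_integral_toReal_smul hf.1.ennreal_ofReal
    (.of_forall fun x => ENNReal.ofReal_lt_top)]
  refine integral_congr_ae ?_
  filter_upwards [hf.ae_nonneg] with x hx
  rw [ENNReal.toReal_ofReal hx, smul_eq_mul, mul_comm]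

end IsGenerator

lemma ae_mem_Icc_genMeasure (f : ℝ → ℝ) : ∀ᵐ x ∂(genMeasure f), x ∈ Set.Icc (0:ℝ) 1 :=
  (withDensity_absolutelyContinuous _ _).ae_le (ae_restrict_mem measurableSet_Icc)

instance (f : ℝ → ℝ) : NullSingletonClass (genMeasure f) := by
  unfold genMeasure
  infer_instance

namespace IsGenerator

variable {f : ℝ → ℝ}

lemma genVar_eq (hf : IsGenerator f) :
    genVar f = (∫ x, x ^ 2 ∂(genMeasure f)) - (∫ x, x ∂(genMeasure f)) ^ 2 := by
  rw [genVar, hf.integral_genMeasure, hf.integral_genMeasure]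

lemma genMAD_eq (hf : IsGenerator f) :
    genMAD f = ∫ p, |p.1 - p.2| ∂((genMeasure f).prod (genMeasure f)) := by
  have := hf.isProbabilityMeasure
  have hind : Integrable (fun p : ℝ × ℝ => |p.1 - p.2| * (f p.1 * f p.2))
      ((volume.restrict (Set.Icc (0:ℝ) 1)).prod (volume.restrict (Set.Icc (0:ℝ) 1))) := by
    refine (hf.integrableOn.mul_prod hf.integrableOn).bdd_mul (c := 1)
      (by fun_prop) ?_
    have hI := ae_restrict_mem (μ := volume) (measurableSet_Icc (a := (0:ℝ)) (b := 1))
    filter_upwards [Measure.quasiMeasurePreserving_fst.ae hI,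
      Measure.quasiMeasurePreserving_snd.ae hI] with p hp hp'
    rw [Real.norm_eq_abs, abs_abs, abs_le]
    exact ⟨by linarith [hp.1, hp'.2], by linarith [hp.2, hp'.1]⟩
  have hpre : (MeasurableEquiv.finTwoArrow (α := ℝ)) ⁻¹'
      (Set.Icc (0:ℝ) 1 ×ˢ Set.Icc (0:ℝ) 1) = Set.univ.pi fun _ : Fin 2 => Set.Icc (0:ℝ) 1 := by
    ext u
    simp only [Set.mem_preimage, Set.mem_prod, Set.mem_univ_pi, Fin.forall_fin_two,
      MeasurableEquiv.finTwoArrow_apply]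
  have hmp := (volume_preserving_finTwoArrow ℝ).setIntegral_preimage_emb
    (MeasurableEquiv.finTwoArrow (α := ℝ)).measurableEmbedding
    (fun p : ℝ × ℝ => |p.1 - p.2| * (f p.1 * f p.2)) (Set.Icc (0:ℝ) 1 ×ˢ Set.Icc (0:ℝ) 1)
  rw [hpre] at hmp
  rw [genMAD, integral_prod _ (integrable_of_continuous_prod (ae_mem_Icc_genMeasure f)
    (by fun_prop))]
  simp_rw [hf.integral_genMeasure]
  refine Eq.trans hmp ?_
  rw [Measure.volume_eq_prod, ← Measure.prod_restrict, integral_prod _ hind]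
  refine integral_congr_ae (.of_forall fun x => ?_)
  simp only
  rw [← integral_mul_const]
  refine integral_congr_ae (.of_forall fun y => ?_)
  simp only
  ring

lemma dssXi_eq (hf : IsGenerator f) :
    dssXi f = 12 * ∫ t in Set.Icc (0:ℝ) 1, (∫ x, centeredStep x t ∂(genMeasure f)) ^ 2 := by
  have := hf.isProbabilityMeasure
  have hν := ae_mem_Icc_genMeasure f
  rw [← integral_quadratic_kernel_eq hν,
    integral_add (integrable_of_continuous_prod hν (by fun_prop))
      (integrable_of_continuous_prod hν (by fun_prop)),
    integral_sub (integrable_of_continuous_prod hν (by fun_prop))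
      (integrable_of_continuous_prod hν (by fun_prop)), integral_const_mul, integral_const_mul,
    integral_sq_sub_eq hν, ← hf.genMAD_eq, ← hf.genVar_eq, dssXi]
  simp
  ring

lemma dssXi_lt_one (hf : IsGenerator f) : dssXi f < 1 := by
  have := hf.isProbabilityMeasure
  have h := integral_sq_sub_lt_integral_abs_sub (ae_mem_Icc_genMeasure f)
  rw [integral_sq_sub_eq (ae_mem_Icc_genMeasure f), ← hf.genMAD_eq, ← hf.genVar_eq] at h
  rw [dssXi]
  linarith

lemma integral_centeredStep (hf : IsGenerator f) {t : ℝ} (ht : t ∈ Set.Icc (0:ℝ) 1) :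
    ∫ x, centeredStep x t ∂(genMeasure f)
      = (∫ x in (0:ℝ)..t, f x) - t + (∫ x in Set.Icc (0:ℝ) 1, x * f x) - 1 / 2 := by
  have := hf.isProbabilityMeasure
  have hν := ae_mem_Icc_genMeasure f
  have hstep : Integrable ((Set.Iic t).indicator (1 : ℝ → ℝ)) (genMeasure f) :=
    (integrable_const (1:ℝ)).indicator measurableSet_Iic
  have h : ∀ x, centeredStep x t = (Set.Iic t).indicator 1 x + (x + (-t - 1 / 2)) := by
    intro x
    by_cases hx : x ≤ t <;> simp [centeredStep, hx] <;> ring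
  simp_rw [h]
  have hind : ∀ x, (Set.Iic t).indicator (1 : ℝ → ℝ) x * f x = (Set.Iic t).indicator f x := by
    intro x
    by_cases hx : x ≤ t <;> simp [hx]
  have hset : Set.Icc (0:ℝ) 1 ∩ Set.Iic t = Set.Icc 0 t := by
    ext x
    simp only [Set.mem_inter_iff, Set.mem_Icc, Set.mem_Iic]
    exact ⟨fun h => ⟨h.1.1, h.2⟩, fun h => ⟨⟨h.1, h.2.trans ht.2⟩, h.2⟩⟩
  rw [integral_add hstep
    (integrable_of_continuous_of_ae_mem_Icc hν (by fun_prop)),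
    integral_add (integrable_of_continuous_of_ae_mem_Icc hν (by fun_prop))
      (integrable_const _), hf.integral_genMeasure, hf.integral_genMeasure (fun x => x)]
  simp_rw [hind]
  rw [setIntegral_indicator measurableSet_Iic, hset, integral_Icc_eq_integral_Ioc,
    ← intervalIntegral.integral_of_le ht.1]
  simp
  ring

lemma dssXi_eq_zero_iff (hf : IsGenerator f) :
    dssXi f = 0 ↔ ∀ᵐ x ∂(volume.restrict (Set.Icc (0:ℝ) 1)), f x = 1 := by
  rw [hf.dssXi_eq]
  have hII : IntervalIntegrable f volume 0 1 := by
    rw [intervalIntegrable_iff_integrableOn_Icc_of_le zero_le_one]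
    exact hf.integrableOn
  set m := ∫ x in Set.Icc (0:ℝ) 1, x * f x with hm
  have hcongr : ∫ t in Set.Icc (0:ℝ) 1, (∫ x, centeredStep x t ∂(genMeasure f)) ^ 2
      = ∫ t in Set.Icc (0:ℝ) 1, ((∫ x in (0:ℝ)..t, f x) - t + m - 1 / 2) ^ 2 :=
    setIntegral_congr_fun measurableSet_Icc fun t ht => by
      simp only [hf.integral_centeredStep ht, hm]
  have hcont : ContinuousOn (fun t => (∫ x in (0:ℝ)..t, f x) - t + m - 1 / 2)
      (Set.Icc (0:ℝ) 1) := by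
    have := intervalIntegral.continuousOn_primitive_interval
      (a := (0:ℝ)) (b := 1) (μ := volume) (f := f) (by
        rw [Set.uIcc_of_le zero_le_one]
        exact hf.integrableOn)
    rw [Set.uIcc_of_le zero_le_one] at this
    fun_prop
  rw [hcongr]
  constructor
  · intro h
    have hz : ∫ t in Set.Icc (0:ℝ) 1, ((∫ x in (0:ℝ)..t, f x) - t + m - 1 / 2) ^ 2 = 0 := by
      linarith
    rw [integral_eq_zero_iff_of_nonneg (fun t => sq_nonneg _)
      (hcont.pow 2).integrableOn_Icc] at hz
    have hae : (fun t => (∫ x in (0:ℝ)..t, f x) - t + m - 1 / 2)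
        =ᵐ[volume.restrict (Set.Icc (0:ℝ) 1)] fun _ => 0 := by
      filter_upwards [hz] with t ht
      exact pow_eq_zero_iff two_ne_zero |>.mp ht
    have heq := Measure.eqOn_Icc_of_ae_eq volume zero_ne_one hae hcont continuousOn_const
    have h0 := heq (Set.left_mem_Icc.mpr zero_le_one)
    simp only [intervalIntegral.integral_same] at h0
    have hF : ∀ t ∈ Set.Icc (0:ℝ) 1, ∫ x in (0:ℝ)..t, f x = t := by
      intro t ht
      have := heq ht
      simp only at this
      linarith
    have hd := hII.ae_hasDerivAt_integral
    rw [← restrict_Ioo_eq_restrict_Icc, ae_restrict_iff' measurableSet_Ioo]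
    filter_upwards [hd] with x hx hx'
    have h1 := hx (by rw [Set.uIcc_of_le zero_le_one]; exact Set.Ioo_subset_Icc_self hx') 0
      (by simp)
    have h2 : HasDerivAt (fun t => ∫ x in (0:ℝ)..t, f x) 1 x := by
      refine (hasDerivAt_id x).congr_of_eventuallyEq ?_
      filter_upwards [Icc_mem_nhds hx'.1 hx'.2] with t ht using hF t ht
    exact h1.unique h2
  · intro h
    have hmv : m = 1 / 2 := by
      rw [hm, integral_congr_ae (g := fun x => x), integral_Icc_eq_integral_Ioc,
        ← intervalIntegral.integral_of_le zero_le_one, integral_id]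
      · norm_num
      · filter_upwards [h] with x hx
        rw [hx, mul_one]
    have hF : ∀ t ∈ Set.Icc (0:ℝ) 1, ∫ x in (0:ℝ)..t, f x = t := by
      intro t ht
      have hsub : ∀ᵐ x ∂(volume.restrict (Set.Ioc 0 t)), f x = 1 :=
        ae_restrict_of_ae_restrict_of_subset
          (fun x (hx : x ∈ Set.Ioc 0 t) => (⟨hx.1.le, hx.2.trans ht.2⟩ : x ∈ Set.Icc 0 1)) h
      rw [intervalIntegral.integral_of_le ht.1, integral_congr_ae hsub]
      simp [ht.1]
    rw [setIntegral_congr_fun (g := fun _ => 0) measurableSet_Icc fun t ht => by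
      simp only [hF t ht, hmv]
      ring]
    simp

lemma dssXi_eq_two_mul_spearmanRho_sub (f : ℝ → ℝ) :
    dssXi f = 2 * spearmanRho f - 3 * kendallTau f := by
  rw [dssXi, spearmanRho, kendallTau]
  ring

end IsGenerator


theorem stmt_13 (f : ℝ → ℝ) (hf : IsGenerator f) :
    (0 ≤ dssXi f ∧ dssXi f < 1)
    ∧ (dssXi f = 0 ↔ ∀ᵐ x ∂(volume.restrict (Set.Icc (0:ℝ) 1)), f x = 1)
    ∧ dssXi f = 2 * spearmanRho f - 3 * kendallTau f
    ∧ (2 * spearmanRho f = 3 * kendallTau f ↔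
        ∀ᵐ x ∂(volume.restrict (Set.Icc (0:ℝ) 1)), f x = 1) := by
  have hrel := IsGenerator.dssXi_eq_two_mul_spearmanRho_sub f
  refine ⟨⟨?_, hf.dssXi_lt_one⟩, hf.dssXi_eq_zero_iff, hrel, ?_⟩
  · rw [hf.dssXi_eq]
    exact mul_nonneg (by norm_num) (integral_nonneg fun t => sq_nonneg _)
  · rw [← hf.dssXi_eq_zero_iff, hrel, sub_eq_zero]
end

section
/- Let d ≥ 2, s ∈ {0,1}^d, let f be a generator, and define C_f^s(u) := ∫_{[0,u]} c_f^s(v) dv for u ∈ [0,1]^d, where [0,u] := Π_j [0,u_j]. Then for each j ∈ {1,…,d} and each u ∈ [0,1]^d with 0 < u_j < 1, the partial derivative ∂C_f^s/∂u_j exists at u and equals ∫_{[0, u_{−j}]} c_f^s(u_j, v_{−j}) dv_{−j} (integration over the coordinates other than j, with the j-th argument fixed at u_j), and the function u ↦ ∂_j C_f^s(u) is continuous on the set V_j := {u ∈ [0,1]^d : 0 < u_j < 1}. -/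
open MeasureTheory

/-- Insert the value `p.1` at the coordinate `j` into the family `p.2` of the other coordinates. -/
def insertCoord {ι : Type*} [DecidableEq ι] (j : ι) (p : ℝ × ({k : ι // k ≠ j} → ℝ)) : ι → ℝ :=
  fun l => if hl : l = j then p.1 else p.2 ⟨l, hl⟩

/-- The sum of the coordinates of `w`, those flagged by `s` being reflected to `1 - w k`. -/
def reflSum {ι : Type*} [Fintype ι] (s : ι → Bool) (w : ι → ℝ) : ℝ :=
  ∑ k, if s k then 1 - w k else w k

lemma measurePreserving_insertCoord {ι : Type*} [Fintype ι] [DecidableEq ι] (j : ι) :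
    MeasurePreserving (insertCoord j) volume volume ∧ MeasurableEmbedding (insertCoord j) := by
  let e₁ := MeasurableEquiv.piEquivPiSubtypeProd (fun _ : ι => ℝ) (fun k => k = j)
  let e₂ := MeasurableEquiv.funUnique {k : ι // k = j} ℝ
  let e₃ := MeasurableEquiv.prodCongr e₂ (MeasurableEquiv.refl ({k : ι // k ≠ j} → ℝ))
  have h₁ : MeasurePreserving e₁ volume volume := by
    have h := volume_preserving_piEquivPiSubtypeProd (fun _ : ι => ℝ) (fun k => k = j)
    rwa [Subsingleton.elim (Subtype.fintype fun k => k = j) (Fintype.subtypeEq j)] at h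
  have h₂ : MeasurePreserving e₂ volume volume := volume_preserving_funUnique _ _
  have h₃ : MeasurePreserving e₃ volume volume := h₂.prod (MeasurePreserving.id _)
  have heq : insertCoord j = (e₁.trans e₃).symm := by
    funext p
    rw [MeasurableEquiv.eq_symm_apply]
    refine Prod.ext ?_ ?_
    · change insertCoord j p _ = p.1
      simp only [insertCoord]
      exact dif_pos (default : {k : ι // k = j}).2
    · funext k
      change insertCoord j p k = p.2 k
      simp only [insertCoord]
      rw [dif_neg k.2]
  rw [heq]
  exact ⟨(h₃.comp h₁).symm (e₁.trans e₃), MeasurableEquiv.measurableEmbedding _⟩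

lemma insertCoord_preimage_pi {ι : Type*} [DecidableEq ι] (j : ι) (A : ι → Set ℝ) :
    insertCoord j ⁻¹' Set.univ.pi A =
      A j ×ˢ Set.univ.pi (fun k : {k : ι // k ≠ j} => A k.1) := by
  ext p
  simp only [Set.mem_preimage, Set.mem_pi, Set.mem_univ, true_imp_iff, Set.mem_prod]
  constructor
  · intro h
    refine ⟨by simpa [insertCoord] using h j, fun k => ?_⟩
    have := h k
    simp only [insertCoord] at this
    rwa [dif_neg k.2] at this
  · rintro ⟨h₁, h₂⟩ l
    by_cases hl : l = j
    · subst hl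
      simpa [insertCoord] using h₁
    · simpa [insertCoord, hl] using h₂ ⟨l, hl⟩

lemma integrableOn_insertCoord_iff {ι : Type*} [Fintype ι] [DecidableEq ι] (j : ι)
    (A : ι → Set ℝ) (h : (ι → ℝ) → ℝ) :
    IntegrableOn (fun p => h (insertCoord j p))
      (A j ×ˢ Set.univ.pi (fun k : {k : ι // k ≠ j} => A k.1)) volume ↔
      IntegrableOn h (Set.univ.pi A) volume := by
  obtain ⟨h₁, h₂⟩ := measurePreserving_insertCoord j
  rw [← insertCoord_preimage_pi, ← h₁.integrableOn_comp_preimage h₂]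
  rfl

lemma setIntegral_insertCoord {ι : Type*} [Fintype ι] [DecidableEq ι] (j : ι)
    (A : ι → Set ℝ) (h : (ι → ℝ) → ℝ) :
    ∫ p in A j ×ˢ Set.univ.pi (fun k : {k : ι // k ≠ j} => A k.1), h (insertCoord j p) =
      ∫ v in Set.univ.pi A, h v := by
  obtain ⟨h₁, h₂⟩ := measurePreserving_insertCoord j
  rw [← insertCoord_preimage_pi, ← h₁.setIntegral_preimage_emb h₂]

lemma reflSum_eq_add {ι : Type*} [Fintype ι] [DecidableEq ι] (j : ι) (s : ι → Bool) (w : ι → ℝ) :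
    reflSum s w = (if s j then 1 - w j else w j) +
      reflSum (fun k : {k : ι // k ≠ j} => s k.1) (fun k => w k.1) :=
  Fintype.sum_eq_add_sum_subtype_ne _ j

lemma reflSum_insertCoord {ι : Type*} [Fintype ι] [DecidableEq ι] (j : ι) (s : ι → Bool)
    (p : ℝ × ({k : ι // k ≠ j} → ℝ)) :
    reflSum s (insertCoord j p) = (if s j then 1 - p.1 else p.1) +
      reflSum (fun k : {k : ι // k ≠ j} => s k.1) p.2 := by
  rw [reflSum_eq_add j]
  congr 2
  · simp [insertCoord]
  · simp [insertCoord]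
  · funext k
    simp only [insertCoord]
    rw [dif_neg k.2]

lemma continuous_reflSum {ι : Type*} [Fintype ι] (s : ι → Bool) : Continuous (reflSum s) := by
  unfold reflSum
  refine continuous_finsetSum _ fun k _ => ?_
  split_ifs <;> fun_prop

section Periodic

variable {g : ℝ → ℝ}

lemma intervalIntegrable_comp_refl (hint : ∀ a b, IntervalIntegrable g volume a b)
    (b : Bool) (y x : ℝ) :
    IntervalIntegrable (fun t => g ((if b then 1 - t else t) + y)) volume 0 x := by
  cases b
  · have := (hint y (x + y)).comp_add_right y
    simpa using this
  · have := (hint (1 + y) (1 + y - x)).comp_sub_left (1 + y)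
    simp only [sub_self, sub_sub_cancel] at this
    simpa [sub_add_eq_add_sub] using this

lemma integral_norm_comp_refl (hper : Function.Periodic g 1) (b : Bool) (y : ℝ) :
    ∫ t in (0:ℝ)..1, ‖g ((if b then 1 - t else t) + y)‖ = ∫ t in (0:ℝ)..1, ‖g t‖ := by
  have hper' : Function.Periodic (fun t => ‖g t‖) 1 := fun t => by simp only [hper t]
  have key := hper'.intervalIntegral_add_eq y 0
  rw [zero_add] at key
  rw [← key]
  cases b
  · have := intervalIntegral.integral_comp_add_right (a := 0) (b := 1) (fun t => ‖g t‖) y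
    simpa [add_comm] using this
  · have := intervalIntegral.integral_comp_sub_left (a := 0) (b := 1) (fun t => ‖g t‖) (1 + y)
    simpa [sub_add_eq_add_sub, add_comm y 1] using this

lemma continuous_primitive_comp_refl (hint : ∀ a b, IntervalIntegrable g volume a b) (b : Bool) :
    Continuous fun p : ℝ × ℝ => ∫ t in (0:ℝ)..p.1, g ((if b then 1 - t else t) + p.2) := by
  have hF := intervalIntegral.continuous_primitive hint 0
  cases b
  · simp only [Bool.false_eq_true, if_false]
    have : ∀ p : ℝ × ℝ, ∫ t in (0:ℝ)..p.1, g (t + p.2) =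
        (∫ t in (0:ℝ)..(p.1 + p.2), g t) - ∫ t in (0:ℝ)..p.2, g t := by
      intro p
      rw [intervalIntegral.integral_interval_sub_left (hint _ _) (hint _ _)]
      simp
    simp only [this]
    exact (hF.comp (by fun_prop)).sub (hF.comp (by fun_prop))
  · simp only [if_true]
    have : ∀ p : ℝ × ℝ, ∫ t in (0:ℝ)..p.1, g (1 - t + p.2) =
        (∫ t in (0:ℝ)..(1 + p.2), g t) - ∫ t in (0:ℝ)..(1 + p.2 - p.1), g t := by
      intro p
      rw [intervalIntegral.integral_interval_sub_left (hint _ _) (hint _ _)]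
      simp [sub_add_eq_add_sub]
    simp only [this]
    exact (hF.comp (by fun_prop)).sub (hF.comp (by fun_prop))

lemma integrableOn_comp_reflSum_cube {ι : Type*} [Fintype ι] [DecidableEq ι] (j : ι)
    (s : ι → Bool) (hmeas : Measurable g) (hper : Function.Periodic g 1)
    (hint : ∀ a b, IntervalIntegrable g volume a b) (a : ℝ) :
    IntegrableOn (fun w => g (a + reflSum s w)) (Set.univ.pi fun _ : ι => Set.Icc (0:ℝ) 1) := by
  rw [← integrableOn_insertCoord_iff j]
  have hm : Measurable fun p : ℝ × ({k : ι // k ≠ j} → ℝ) =>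
      g (a + reflSum s (insertCoord j p)) :=
    hmeas.comp (((continuous_reflSum s).measurable.comp
      (measurePreserving_insertCoord j).1.measurable).const_add a)
  rw [IntegrableOn, Measure.volume_eq_prod, ← Measure.prod_restrict,
    integrable_prod_iff' hm.aestronglyMeasurable]
  have hrw : ∀ (t : ℝ) (w : {k : ι // k ≠ j} → ℝ), g (a + reflSum s (insertCoord j (t, w))) =
      g ((if s j then 1 - t else t) + (a + reflSum (fun k : {k : ι // k ≠ j} => s k.1) w)) := by
    intro t w
    rw [reflSum_insertCoord]
    congr 1
    ring
  simp only [hrw]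
  constructor
  · refine Filter.Eventually.of_forall fun w => ?_
    exact (intervalIntegrable_iff_integrableOn_Icc_of_le zero_le_one).1
      (intervalIntegrable_comp_refl hint _ _ _)
  · simp only [integral_Icc_eq_integral_Ioc, ← intervalIntegral.integral_of_le (zero_le_one (α := ℝ)),
      integral_norm_comp_refl hper]
    rw [← IntegrableOn]
    refine integrableOn_const ?_
    exact (isCompact_univ_pi fun _ => isCompact_Icc).measure_lt_top.ne

lemma integrableOn_insertCoord_box {ι : Type*} [Fintype ι] [DecidableEq ι] (j : ι)
    (s : ι → Bool) (hmeas : Measurable g) (hper : Function.Periodic g 1)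
    (hint : ∀ a b, IntervalIntegrable g volume a b) (a : ℝ) (v : ι → ℝ)
    (hv : ∀ k, v k ∈ Set.Icc (0:ℝ) 1) :
    IntegrableOn (fun p : ℝ × ({k : ι // k ≠ j} → ℝ) => g (a + reflSum s (insertCoord j p)))
      (Set.Icc 0 (v j) ×ˢ Set.univ.pi (fun k : {k : ι // k ≠ j} => Set.Icc 0 (v k.1))) := by
  rw [integrableOn_insertCoord_iff j (fun k => Set.Icc 0 (v k)) (fun w => g (a + reflSum s w))]
  exact (integrableOn_comp_reflSum_cube j s hmeas hper hint a).mono_set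
    (Set.pi_mono fun k _ => Set.Icc_subset_Icc le_rfl (hv k).2)

/-- Integrating over the coordinate `j` last. -/
lemma setIntegral_comp_reflSum_eq_outer {ι : Type*} [Fintype ι] [DecidableEq ι] (j : ι)
    (s : ι → Bool) (hmeas : Measurable g) (hper : Function.Periodic g 1)
    (hint : ∀ a b, IntervalIntegrable g volume a b) (a : ℝ) (v : ι → ℝ)
    (hv : ∀ k, v k ∈ Set.Icc (0:ℝ) 1) :
    ∫ w in Set.univ.pi fun k => Set.Icc 0 (v k), g (a + reflSum s w) =
      ∫ t in (0:ℝ)..v j, ∫ w in Set.univ.pi (fun k : {k : ι // k ≠ j} => Set.Icc 0 (v k.1)),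
        g (a + (if s j then 1 - t else t) + reflSum (fun k : {k : ι // k ≠ j} => s k.1) w) := by
  rw [← setIntegral_insertCoord j, Measure.volume_eq_prod, setIntegral_prod _ (by
    exact integrableOn_insertCoord_box j s hmeas hper hint a v hv),
    integral_Icc_eq_integral_Ioc, intervalIntegral.integral_of_le (hv j).1]
  simp only [reflSum_insertCoord, add_assoc]

/-- Integrating over the coordinate `j` first. -/
lemma setIntegral_comp_reflSum_eq_inner {ι : Type*} [Fintype ι] [DecidableEq ι] (j : ι)
    (s : ι → Bool) (hmeas : Measurable g) (hper : Function.Periodic g 1)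
    (hint : ∀ a b, IntervalIntegrable g volume a b) (a : ℝ) (v : ι → ℝ)
    (hv : ∀ k, v k ∈ Set.Icc (0:ℝ) 1) :
    ∫ w in Set.univ.pi fun k => Set.Icc 0 (v k), g (a + reflSum s w) =
      ∫ w in Set.univ.pi (fun k : {k : ι // k ≠ j} => Set.Icc 0 (v k.1)), ∫ t in (0:ℝ)..v j,
        g ((if s j then 1 - t else t) +
          (a + reflSum (fun k : {k : ι // k ≠ j} => s k.1) w)) := by
  have hi := integrableOn_insertCoord_box j s hmeas hper hint a v hv
  rw [IntegrableOn, Measure.volume_eq_prod, ← Measure.prod_restrict] at hi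
  rw [← setIntegral_insertCoord j, Measure.volume_eq_prod, ← Measure.prod_restrict,
    integral_prod_symm _ hi]
  simp only [integral_Icc_eq_integral_Ioc, ← intervalIntegral.integral_of_le (hv j).1,
    reflSum_insertCoord, add_left_comm a]

/-- Integrals of a bounded jointly continuous integrand over a box depend continuously on the box
and on the parameter. -/
lemma continuousOn_setIntegral_box {ι : Type*} [Fintype ι] {X : Type*}
    [TopologicalSpace X] [FirstCountableTopology X] {S : Set X} {v : X → ι → ℝ}
    {H : X → (ι → ℝ) → ℝ} {M : ℝ} (hv : ContinuousOn v S)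
    (hv1 : ∀ x ∈ S, ∀ k, v x k ≤ 1)
    (hH : Continuous (Function.uncurry H)) (hM : ∀ x ∈ S, ∀ w, ‖H x w‖ ≤ M) :
    ContinuousOn (fun x => ∫ w in Set.univ.pi fun k => Set.Icc 0 (v x k), H x w) S := by
  have hbox : ∀ x, MeasurableSet (Set.univ.pi fun k => Set.Icc (0:ℝ) (v x k)) := fun x =>
    MeasurableSet.univ_pi fun k => measurableSet_Icc
  have heq : Set.EqOn (fun x => ∫ w in Set.univ.pi fun k => Set.Icc 0 (v x k), H x w)
      (fun x => ∫ w in Set.univ.pi fun _ : ι => Set.Icc (0:ℝ) 1,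
        (Set.univ.pi fun k => Set.Icc 0 (v x k)).indicator (H x) w) S := by
    intro x hx
    simp only
    rw [setIntegral_indicator (hbox x), Set.inter_eq_right.2]
    exact Set.pi_mono fun k _ => Set.Icc_subset_Icc le_rfl (hv1 x hx k)
  refine ContinuousOn.congr (fun x₀ hx₀ => ?_) heq
  refine continuousWithinAt_of_dominated (bound := fun _ => M) ?_ ?_ ?_ ?_
  · refine Filter.Eventually.of_forall fun x => ?_
    have : Continuous (H x) := hH.comp (by fun_prop : Continuous fun w => (x, w))
    exact this.aestronglyMeasurable.indicator (hbox x)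
  · filter_upwards [self_mem_nhdsWithin] with x hx
    refine Filter.Eventually.of_forall fun w => ?_
    exact (norm_indicator_le_norm_self _ _).trans (hM x hx w)
  · refine integrableOn_const ?_
    exact (isCompact_univ_pi fun _ => isCompact_Icc).measure_lt_top.ne
  · have hne : ∀ᵐ w : ι → ℝ, ∀ k, w k ≠ v x₀ k := by
      rw [ae_all_iff]
      intro k
      have := Measure.pi_hyperplane (fun _ : ι => (volume : Measure ℝ)) k (v x₀ k)
      rw [← volume_pi] at this
      simpa [ae_iff] using this
    filter_upwards [ae_restrict_of_ae hne] with w hw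
    have hHw : ContinuousWithinAt (fun x => H x w) S x₀ :=
      (hH.comp (by fun_prop : Continuous fun x => (x, w))).continuousWithinAt
    have hvk : ∀ k, Filter.Tendsto (fun x => v x k) (nhdsWithin x₀ S) (nhds (v x₀ k)) :=
      fun k => tendsto_pi_nhds.1 (hv x₀ hx₀) k
    by_cases hmem : w ∈ Set.univ.pi fun k => Set.Icc 0 (v x₀ k)
    · refine hHw.congr_of_eventuallyEq ?_ (Set.indicator_of_mem hmem _)
      have : ∀ᶠ x in nhdsWithin x₀ S, ∀ k, w k < v x k := by
        rw [Filter.eventually_all]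
        exact fun k => (hvk k).eventually_const_lt
          (lt_of_le_of_ne (hmem k (Set.mem_univ k)).2 (hw k))
      filter_upwards [this] with x hx
      have hwx : w ∈ Set.univ.pi fun k => Set.Icc 0 (v x k) :=
        fun k hk => ⟨(hmem k hk).1, (hx k).le⟩
      exact Set.indicator_of_mem hwx _
    · refine (continuousWithinAt_const (b := (0:ℝ))).congr_of_eventuallyEq ?_
        (Set.indicator_of_notMem hmem _)
      simp only [Set.mem_pi, Set.mem_univ, true_imp_iff, not_forall, Set.mem_Icc, not_and_or,
        not_le] at hmem
      obtain ⟨k, hk⟩ := hmem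
      have : ∀ᶠ x in nhdsWithin x₀ S, w k ∉ Set.Icc 0 (v x k) := by
        rcases hk with hk | hk
        · exact Filter.Eventually.of_forall fun x hx => absurd hx.1 (not_le.2 hk)
        · filter_upwards [(hvk k).eventually_lt_const hk] with x hx h
          exact absurd h.2 (not_le.2 hx)
      filter_upwards [this] with x hx
      have hwx : w ∉ Set.univ.pi fun k => Set.Icc 0 (v x k) :=
        fun h => hx (h k (Set.mem_univ k))
      exact Set.indicator_of_notMem hwx _

lemma continuousOn_setIntegral_comp_reflSum {ι : Type*} [Fintype ι] [DecidableEq ι] (j : ι)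
    (s : ι → Bool) (hmeas : Measurable g) (hper : Function.Periodic g 1)
    (hint : ∀ a b, IntervalIntegrable g volume a b) :
    ContinuousOn (fun p : ℝ × (ι → ℝ) =>
      ∫ w in Set.univ.pi fun k => Set.Icc 0 (p.2 k), g (p.1 + reflSum s w))
      {p | ∀ k, p.2 k ∈ Set.Icc (0:ℝ) 1} := by
  refine ContinuousOn.congr ?_ fun p hp =>
    setIntegral_comp_reflSum_eq_inner j s hmeas hper hint p.1 p.2 hp
  refine continuousOn_setIntegral_box (M := ∫ t in (0:ℝ)..1, ‖g t‖)
    (v := fun (p : ℝ × (ι → ℝ)) (k : {k : ι // k ≠ j}) => p.2 k.1)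
    (by fun_prop) (fun p hp k => (hp k.1).2) ?_ ?_
  · have := continuous_reflSum (fun k : {k : ι // k ≠ j} => s k.1)
    exact (continuous_primitive_comp_refl hint (s j)).comp
      (by fun_prop : Continuous fun q : (ℝ × (ι → ℝ)) × ({k : ι // k ≠ j} → ℝ) =>
        (q.1.2 j, q.1.1 + reflSum (fun k : {k : ι // k ≠ j} => s k.1) q.2))
  · intro p hp w
    refine (intervalIntegral.norm_integral_le_integral_norm (hp j).1).trans ?_
    rw [← integral_norm_comp_refl hper (s j)
      (p.1 + reflSum (fun k : {k : ι // k ≠ j} => s k.1) w)]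
    exact intervalIntegral.integral_mono_interval le_rfl (hp j).1 (hp j).2
      (Filter.Eventually.of_forall fun t => norm_nonneg _)
      (intervalIntegrable_comp_refl hint _ _ _).norm

end Periodic

lemma IsGenerator.measurable_comp_fract {f : ℝ → ℝ} (hf : IsGenerator f) :
    Measurable fun x => f (Int.fract x) :=
  hf.1.comp measurable_fract

lemma periodic_comp_fract (f : ℝ → ℝ) : Function.Periodic (fun x => f (Int.fract x)) 1 :=
  fun x => by simp only [Int.fract_add_one]

lemma IsGenerator.intervalIntegrable_comp_fract {f : ℝ → ℝ} (hf : IsGenerator f) (a b : ℝ) :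
    IntervalIntegrable (fun x => f (Int.fract x)) volume a b := by
  refine (periodic_comp_fract f).intervalIntegrable₀ one_ne_zero ?_ a b
  have hfi : IntegrableOn f (Set.Icc (0:ℝ) 1) := by
    by_contra h
    have := hf.2.2
    rw [integral_undef h] at this
    exact zero_ne_one this
  rw [intervalIntegrable_iff_integrableOn_Ico_of_le zero_le_one]
  refine (hfi.mono_set Set.Ico_subset_Icc_self).congr_fun (fun x hx => ?_) measurableSet_Ico
  simp only [Int.fract_eq_self.2 hx]

theorem stmt_17 (d : ℕ) (hd : 2 ≤ d) (s : Fin d → Bool) (f : ℝ → ℝ) (hf : IsGenerator f)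
    (c : (Fin d → ℝ) → ℝ)
    (hc : ∀ u : Fin d → ℝ, c u = f (Int.fract (∑ k : Fin d, if s k then 1 - u k else u k)))
    (C : (Fin d → ℝ) → ℝ)
    (hC : ∀ u : Fin d → ℝ, C u = ∫ v in Set.univ.pi (fun j : Fin d => Set.Icc (0:ℝ) (u j)), c v)
    (D : Fin d → (Fin d → ℝ) → ℝ)
    (hD : ∀ (j : Fin d) (u : Fin d → ℝ), D j u =
      ∫ w in Set.univ.pi (fun k : {k : Fin d // k ≠ j} => Set.Icc (0:ℝ) (u k.1)),
        c (fun l : Fin d => if hl : l = j then u j else w ⟨l, hl⟩)) :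
    ∀ (j : Fin d) (u : Fin d → ℝ),
      (∀ k, u k ∈ Set.Icc (0:ℝ) 1) → 0 < u j → u j < 1 →
      HasDerivAt (fun x : ℝ => C (Function.update u j x)) (D j u) (u j)
      ∧ ContinuousOn (D j)
          {u : Fin d → ℝ | (∀ k, u k ∈ Set.Icc (0:ℝ) 1) ∧ 0 < u j ∧ u j < 1} := by
  intro j u hu hu0 hu1
  have hmeas := hf.measurable_comp_fract
  have hper := periodic_comp_fract f
  have hint := hf.intervalIntegrable_comp_fract
  set g : ℝ → ℝ := fun x => f (Int.fract x) with hg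
  have : Nontrivial (Fin d) := Fin.nontrivial_iff_two_le.2 hd
  obtain ⟨i, hi⟩ := exists_ne j
  let s' : {k : Fin d // k ≠ j} → Bool := fun k => s k.1
  let G : ℝ × ({k : Fin d // k ≠ j} → ℝ) → ℝ := fun p =>
    ∫ w in Set.univ.pi fun k => Set.Icc 0 (p.2 k), g (p.1 + reflSum s' w)
  have hG : ContinuousOn G {p | ∀ k, p.2 k ∈ Set.Icc (0:ℝ) 1} :=
    continuousOn_setIntegral_comp_reflSum ⟨i, hi⟩ s' hmeas hper hint
  have hcg : ∀ v, c v = g (0 + reflSum s v) := fun v => by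
    rw [hc, zero_add]
    rfl
  have hDG : ∀ v : Fin d → ℝ, D j v = G (if s j then 1 - v j else v j, fun k => v k.1) := by
    intro v
    rw [hD]
    refine integral_congr_ae (Filter.Eventually.of_forall fun w => ?_)
    change c (insertCoord j (v j, w)) = _
    rw [hcg, zero_add, reflSum_insertCoord]
  have hrefl : Continuous fun t : ℝ => if s j then 1 - t else t := by
    split_ifs <;> fun_prop
  constructor
  · have hcont : Continuous fun t : ℝ =>
        G (if s j then 1 - t else t, fun k : {k : Fin d // k ≠ j} => u k.1) := by
      refine hG.comp_continuous (hrefl.prodMk continuous_const) fun t k => hu k.1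
    have hder := (hcont.integral_hasStrictDerivAt 0 (u j)).hasDerivAt
    rw [hDG]
    refine hder.congr_of_eventuallyEq ?_
    filter_upwards [Ioo_mem_nhds hu0 hu1] with x hx
    have hux : ∀ k, Function.update u j x k ∈ Set.Icc (0:ℝ) 1 := by
      intro k
      by_cases hk : k = j
      · subst hk
        simpa using Set.Ioo_subset_Icc_self hx
      · simpa [hk] using hu k
    rw [hC]
    simp only [hcg]
    rw [setIntegral_comp_reflSum_eq_outer j s hmeas hper hint 0 _ hux, Function.update_self]
    have hne : ∀ k : {k : Fin d // k ≠ j}, Function.update u j x k.1 = u k.1 := fun k =>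
      Function.update_of_ne k.2 _ _
    simp only [hne, zero_add]
    rfl
  · refine ContinuousOn.congr ?_ fun v _ => hDG v
    refine hG.comp (Continuous.continuousOn ?_) fun v hv k => hv.1 k.1
    exact (hrefl.comp (continuous_apply j)).prodMk (by fun_prop)
end
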